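/- Fix an integer q ≥ 5. For all n ≥ 1, the sum â_n of the values of all type-A vertices and the sum b̂_n of the values of all type-B vertices in row n of the hyperbolic Pascal triangle {4,q} satisfy the coupled recurrences â_{n+1} = 2·â_n + 2·b̂_n + 2 and b̂_{n+1} = (q−4)·â_n + (q−3)·b̂_n, with â_1 = 0, b̂_1 = 0. -/

import Mathlib

/-- Type of a vertex in a hyperbolic Pascal triangle: winger, A, or B. -/
inductive HVType where
  | W : HVType
  | A : HVType
  | B : HVType
deriving DecidableEq, Repr

/-- Number of type-B children produced by a vertex of the given type
in the hyperbolic Pascal triangle `{4,q}`. -/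
def hBCount (q : ℕ) : HVType → ℕ
  | .A => q - 4
  | .B => q - 3
  | .W => 0

/-- The inner part of the next row: for each pair of consecutive vertices a shared
type-A child whose value is the sum of the parents' values, followed by the
type-B copies of the right parent. -/
def hMid (q : ℕ) : List (HVType × ℕ) → List (HVType × ℕ)
  | a :: b :: rest =>
      (HVType.A, a.2 + b.2) ::
        (List.replicate (hBCount q b.1) (HVType.B, b.2) ++ hMid q (b :: rest))
  | _ => []

/-- Row `n` of the hyperbolic Pascal triangle `{4,q}`, as a list of
(type, value) pairs read from left to right. -/
def hRow (q : ℕ) : ℕ → List (HVType × ℕ)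
  | 0 => [(HVType.W, 1)]
  | n + 1 => (HVType.W, 1) :: (hMid q (hRow q n) ++ [(HVType.W, 1)])

/-- Number of type-A vertices of row `n`. -/
def hCountA (q n : ℕ) : ℕ := ((hRow q n).filter (fun v => v.1 = HVType.A)).length

/-- Number of type-B vertices of row `n`. -/
def hCountB (q n : ℕ) : ℕ := ((hRow q n).filter (fun v => v.1 = HVType.B)).length

/-- Sum of the values of the type-A vertices of row `n`. -/
def hSumA (q n : ℕ) : ℕ :=
  (((hRow q n).filter (fun v => v.1 = HVType.A)).map Prod.snd).sum

/-- Sum of the values of the type-B vertices of row `n`. -/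
def hSumB (q n : ℕ) : ℕ :=
  (((hRow q n).filter (fun v => v.1 = HVType.B)).map Prod.snd).sum

/-- The number `s_n` of vertices of row `n`. -/
def hLen (q n : ℕ) : ℕ := (hRow q n).length

/-- The value of the `k`-th (0-indexed) vertex of row `n`. -/
def hVal (q n k : ℕ) : ℕ := ((hRow q n).getD k (HVType.W, 0)).2

/-- The type of the `k`-th (0-indexed) vertex of row `n`. -/
def hType (q n k : ℕ) : HVType := ((hRow q n).getD k (HVType.W, 0)).1

/-- Sum of the values of the vertices of type `t` in a list of vertices. -/
def typeSum (t : HVType) (l : List (HVType × ℕ)) : ℕ :=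
  ((l.filter (fun v => v.1 = t)).map Prod.snd).sum

theorem typeSum_nil (t : HVType) : typeSum t [] = 0 := rfl

theorem typeSum_cons (t : HVType) (v : HVType × ℕ) (l : List (HVType × ℕ)) :
    typeSum t (v :: l) = (if v.1 = t then v.2 else 0) + typeSum t l := by
  by_cases h : v.1 = t <;> simp [typeSum, h]

theorem typeSum_append (t : HVType) (l₁ l₂ : List (HVType × ℕ)) :
    typeSum t (l₁ ++ l₂) = typeSum t l₁ + typeSum t l₂ := by
  simp [typeSum]

theorem typeSum_replicate (t s : HVType) (k x : ℕ) :
    typeSum t (List.replicate k (s, x)) = if s = t then k * x else 0 := by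
  by_cases h : s = t <;> simp [typeSum, h]

/-- In the inner part built from a row ending in a winger of value `1`, each vertex strictly between
the first and the last contributes its value to two type-A children. -/
theorem typeSum_A_hMid (q : ℕ) (l : List (HVType × ℕ)) (a : HVType × ℕ) (h : ∀ v ∈ l, v.1 ≠ .W) :
    typeSum .A (hMid q (a :: (l ++ [(.W, 1)]))) =
      a.2 + 2 * typeSum .A l + 2 * typeSum .B l + 1 := by
  induction l generalizing a with
  | nil => simp [hMid, typeSum_cons, typeSum_nil, hBCount]
  | cons b l ih =>
    obtain ⟨hb, hl⟩ := List.forall_mem_cons.mp h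
    rw [List.cons_append, hMid, typeSum_cons, typeSum_append, typeSum_replicate, ih b hl]
    obtain ⟨t, x⟩ := b
    cases t <;> simp [typeSum_cons] at hb ⊢ <;> ring

/-- In the inner part built from a row ending in a winger, each type-A vertex strictly between the
first and the last has `q - 4` type-B children of its own value, and each type-B vertex `q - 3`. -/
theorem typeSum_B_hMid (q : ℕ) (l : List (HVType × ℕ)) (a : HVType × ℕ) :
    typeSum .B (hMid q (a :: (l ++ [(.W, 1)]))) =
      (q - 4) * typeSum .A l + (q - 3) * typeSum .B l := by
  induction l generalizing a with
  | nil => simp [hMid, typeSum_cons, typeSum_nil, hBCount]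
  | cons b l ih =>
    rw [List.cons_append, hMid, typeSum_cons, typeSum_append, typeSum_replicate, ih b]
    obtain ⟨t, x⟩ := b
    cases t <;> simp [typeSum_cons, hBCount] <;> ring

theorem type_ne_W_of_mem_hMid (q : ℕ) (l : List (HVType × ℕ)) : ∀ v ∈ hMid q l, v.1 ≠ .W := by
  induction l with
  | nil => simp [hMid]
  | cons a l ih =>
    cases l with
    | nil => simp [hMid]
    | cons b l =>
      intro v hv
      rw [hMid, List.mem_cons, List.mem_append, List.mem_replicate] at hv
      rcases hv with rfl | ⟨-, rfl⟩ | hv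
      · simp
      · simp
      · exact ih v hv

/-- The two wingers of a row do not contribute to the sum over another type. -/
theorem typeSum_hRow_succ (q n : ℕ) {t : HVType} (ht : t ≠ .W) :
    typeSum t (hRow q (n + 1)) = typeSum t (hMid q (hRow q n)) := by
  simp [hRow, typeSum_cons, typeSum_append, typeSum_nil, ht.symm]

/-- For `q ≥ 5`, the sums of the values of the type-A and type-B vertices
in the rows of the hyperbolic Pascal triangle `{4,q}` satisfy
`â_{n+1} = 2·â_n + 2·b̂_n + 2` and `b̂_{n+1} = (q-4)·â_n + (q-3)·b̂_n` for `n ≥ 1`,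
with `â_1 = 0`, `b̂_1 = 0`. -/
theorem stmt_3 (q : ℕ) (hq : 5 ≤ q) :
    hSumA q 1 = 0 ∧ hSumB q 1 = 0 ∧
    ∀ n, 1 ≤ n →
      hSumA q (n + 1) = 2 * hSumA q n + 2 * hSumB q n + 2 ∧
      hSumB q (n + 1) = (q - 4) * hSumA q n + (q - 3) * hSumB q n := by
  refine ⟨rfl, rfl, fun n hn => ?_⟩
  obtain ⟨m, rfl⟩ := Nat.exists_eq_add_of_le' hn
  change typeSum .A (hRow q (m + 1 + 1)) =
      2 * typeSum .A (hRow q (m + 1)) + 2 * typeSum .B (hRow q (m + 1)) + 2 ∧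
    typeSum .B (hRow q (m + 1 + 1)) =
      (q - 4) * typeSum .A (hRow q (m + 1)) + (q - 3) * typeSum .B (hRow q (m + 1))
  have hA : HVType.A ≠ .W := by decide
  have hB : HVType.B ≠ .W := by decide
  rw [typeSum_hRow_succ q (m + 1) hA, typeSum_hRow_succ q (m + 1) hB, typeSum_hRow_succ q m hA,
    typeSum_hRow_succ q m hB, hRow, typeSum_A_hMid q _ _ (type_ne_W_of_mem_hMid q _),
    typeSum_B_hMid]
  exact ⟨by ring, rfl⟩
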